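/- For n ≥ 1 let φ_{2n}: (ℝ×(0,∞))^n → ℝ^{2n} be the map φ_{2n}(α_1,β_1,…,α_n,β_n) = ((T)_{11},(T²)_{11},…,(T^{2n})_{11}), where T is the (n+1)×(n+1) symmetric tridiagonal matrix with diagonal (α_1,…,α_n,0) and off-diagonal (√β_1,…,√β_n). Then φ_{2n} is differentiable and the determinant of its Jacobian matrix at (α_1,β_1,…,α_n,β_n) (with respect to the coordinate order α_1,β_1,α_2,…,α_n,β_n) equals ∏_{j=1}^{n−1} β_j^{2n−2j}. -/

import Mathlib

open MeasureTheory Real Filter Topology Polynomial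

noncomputable section
/-- The symmetric tridiagonal (Jacobi) matrix of size `(N+1) × (N+1)` with diagonal entries
`a 0, a 1, …, a N` and off-diagonal entries `√(b 0), …, √(b (N-1))`. -/
def jacobiT (N : ℕ) (a b : ℕ → ℝ) : Matrix (Fin (N + 1)) (Fin (N + 1)) ℝ :=
  Matrix.of fun i j =>
    if (i : ℕ) = (j : ℕ) then a (i : ℕ)
    else if (i : ℕ) + 1 = (j : ℕ) then Real.sqrt (b (i : ℕ))
    else if (j : ℕ) + 1 = (i : ℕ) then Real.sqrt (b (j : ℕ))
    else 0

/-- The map `φ_{2n}` in the coordinates `(α_1, β_1, α_2, β_2, …, α_n, β_n)`: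
`v ⟨2i⟩ = α_{i+1}`, `v ⟨2i+1⟩ = β_{i+1}`. -/
def phiEven (n : ℕ) (v : Fin (2 * n) → ℝ) : Fin (2 * n) → ℝ :=
  fun k =>
    ((jacobiT n
        (fun i => if h : 2 * i < 2 * n then v ⟨2 * i, h⟩ else 0)
        (fun i => if h : 2 * i + 1 < 2 * n then v ⟨2 * i + 1, h⟩ else 0))
      ^ ((k : ℕ) + 1)) 0 0

/-- The weighted count of Motzkin paths of length `k` from height `0` to height `i`, with weight
`a j` for a level step at height `j` and `b j` for a down step from `j + 1` to `j`. -/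
def motzkinWeight (a b : ℕ → ℝ) : ℕ → ℕ → ℝ
  | 0, 0 => 1
  | 0, _ + 1 => 0
  | k + 1, 0 => a 0 * motzkinWeight a b k 0 + b 0 * motzkinWeight a b k 1
  | k + 1, i + 1 => a (i + 1) * motzkinWeight a b k (i + 1) + motzkinWeight a b k i
      + b (i + 1) * motzkinWeight a b k (i + 2)

/-- The derivative of `motzkinWeight` in the direction `(a', b')`. -/
def motzkinDeriv {E : Type*} [NormedAddCommGroup E] [NormedSpace ℝ E]
    (a b : ℕ → ℝ) (a' b' : ℕ → E →L[ℝ] ℝ) : ℕ → ℕ → E →L[ℝ] ℝ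
  | 0, _ => 0
  | k + 1, 0 => a 0 • motzkinDeriv a b a' b' k 0 + motzkinWeight a b k 0 • a' 0
      + (b 0 • motzkinDeriv a b a' b' k 1 + motzkinWeight a b k 1 • b' 0)
  | k + 1, i + 1 => a (i + 1) • motzkinDeriv a b a' b' k (i + 1)
      + motzkinWeight a b k (i + 1) • a' (i + 1)
      + motzkinDeriv a b a' b' k i
      + (b (i + 1) • motzkinDeriv a b a' b' k (i + 2)
        + motzkinWeight a b k (i + 2) • b' (i + 1))

theorem motzkinWeight_eq_zero_of_lt (a b : ℕ → ℝ) {k i : ℕ} (h : k < i) :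
    motzkinWeight a b k i = 0 := by
  induction k generalizing i with
  | zero => obtain _ | i := i <;> simp_all [motzkinWeight]
  | succ k ih =>
    obtain _ | i := i
    · omega
    · simp [motzkinWeight, ih (show k < i + 1 by omega), ih (show k < i by omega),
        ih (show k < i + 2 by omega)]

theorem motzkinWeight_self (a b : ℕ → ℝ) (k : ℕ) : motzkinWeight a b k k = 1 := by
  induction k with
  | zero => simp [motzkinWeight]
  | succ k ih =>
    simp [motzkinWeight, ih, motzkinWeight_eq_zero_of_lt a b (show k < k + 1 by omega),
      motzkinWeight_eq_zero_of_lt a b (show k < k + 2 by omega)]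

theorem jacobiT_mulVec_apply {N : ℕ} (a b g : ℕ → ℝ) (hN : b N = 0) (i : Fin (N + 1)) :
    ∑ j : Fin (N + 1), jacobiT N a b i j * g j =
      a i * g i + √(b i) * g (i + 1)
        + if (i : ℕ) = 0 then 0 else √(b (i - 1)) * g (i - 1) := by
  obtain ⟨i, hi⟩ := i
  have hsplit (j : ℕ) :
      (if i = j then a i else if i + 1 = j then √(b i) else if j + 1 = i then √(b j) else 0) * g j
        = (if i = j then a j * g j else 0) + (if i + 1 = j then √(b i) * g j else 0)
          + if i - 1 = j then (if i = 0 then 0 else √(b j) * g j) else 0 := by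
    split_ifs <;> first | omega | (subst_vars; simp)
  simp only [jacobiT, Matrix.of_apply]
  rw [Fin.sum_univ_eq_sum_range (fun j => (if i = j then a i else if i + 1 = j then √(b i)
    else if j + 1 = i then √(b j) else 0) * g j) (N + 1)]
  simp only [hsplit, Finset.sum_add_distrib, Finset.sum_ite_eq, Finset.mem_range]
  rw [if_pos hi, if_pos (show i - 1 < N + 1 by omega)]
  congr 2
  split_ifs with h
  · rfl
  · obtain rfl : i = N := by omega
    simp [hN]

theorem jacobiT_pow_apply_zero {N : ℕ} {a b : ℕ → ℝ} (hb : ∀ i, 0 ≤ b i) (hN : b N = 0)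
    (k : ℕ) (i : Fin (N + 1)) :
    (jacobiT N a b ^ k) i 0 = (∏ j ∈ Finset.range i, √(b j)) * motzkinWeight a b k i := by
  induction k generalizing i with
  | zero =>
    obtain ⟨_ | i, hi⟩ := i <;> simp [motzkinWeight, Fin.ext_iff]
  | succ k ih =>
    rw [pow_succ', Matrix.mul_apply]
    simp only [ih]
    rw [jacobiT_mulVec_apply a b
      (fun j => (∏ l ∈ Finset.range j, √(b l)) * motzkinWeight a b k j) hN]
    obtain ⟨_ | i, hi⟩ := i
    · have := Real.mul_self_sqrt (hb 0)
      simp only [motzkinWeight, Finset.prod_range_succ, Finset.prod_range_zero, if_true]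
      linear_combination motzkinWeight a b k 1 * this
    · have := Real.mul_self_sqrt (hb (i + 1))
      simp only [motzkinWeight, Finset.prod_range_succ, Nat.add_sub_cancel,
        Nat.add_one_ne_zero, if_false]
      linear_combination (∏ l ∈ Finset.range i, √(b l)) * √(b i) *
        motzkinWeight a b k (i + 2) * this

section Deriv

variable {E : Type*} [NormedAddCommGroup E] [NormedSpace ℝ E]

theorem hasFDerivAt_motzkinWeight {a b : ℕ → E → ℝ} {a' b' : ℕ → E →L[ℝ] ℝ} {v : E}
    (ha : ∀ i, HasFDerivAt (a i) (a' i) v) (hb : ∀ i, HasFDerivAt (b i) (b' i) v) (k i : ℕ) :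
    HasFDerivAt (fun w => motzkinWeight (fun j => a j w) (fun j => b j w) k i)
      (motzkinDeriv (fun j => a j v) (fun j => b j v) a' b' k i) v := by
  induction k generalizing i with
  | zero => obtain _ | i := i <;> exact hasFDerivAt_const _ v
  | succ k ih =>
    obtain _ | i := i
    · exact ((ha 0).mul (ih 0)).add ((hb 0).mul (ih 1))
    · exact (((ha (i + 1)).mul (ih (i + 1))).add (ih i)).add ((hb (i + 1)).mul (ih (i + 2)))

variable (a b : ℕ → ℝ) (a' b' : ℕ → E →L[ℝ] ℝ)

theorem motzkinDeriv_eq_zero_of_le {k i : ℕ} (h : k ≤ i) : motzkinDeriv a b a' b' k i = 0 := by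
  induction k generalizing i with
  | zero => rfl
  | succ k ih =>
    obtain _ | i := i
    · omega
    · simp [motzkinDeriv, ih (show k ≤ i + 1 by omega), ih (show k ≤ i by omega),
        ih (show k ≤ i + 2 by omega),
        motzkinWeight_eq_zero_of_lt a b (show k < i + 1 by omega),
        motzkinWeight_eq_zero_of_lt a b (show k < i + 2 by omega)]

variable {a' b'} {M : ℕ} {e : E}

theorem motzkinDeriv_apply_eq_zero
    (ha : ∀ i, a' i e = if 2 * i = M then 1 else 0)
    (hb : ∀ i, b' i e = if 2 * i + 1 = M then 1 else 0)
    {k i : ℕ} (h : k + i ≤ M) :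
    motzkinDeriv a b a' b' k i e = 0 := by
  induction k generalizing i with
  | zero => rfl
  | succ k ih =>
    have h₁ : motzkinWeight a b k i * a' i e = 0 := by
      rw [ha]
      split_ifs
      · rw [motzkinWeight_eq_zero_of_lt a b (show k < i by omega), zero_mul]
      · simp
    have h₂ : motzkinWeight a b k (i + 1) * b' i e = 0 := by
      rw [hb]
      split_ifs
      · rw [motzkinWeight_eq_zero_of_lt a b (show k < i + 1 by omega), zero_mul]
      · simp
    have h₃ := ih (show k + i ≤ M by omega)
    have h₄ := ih (show k + (i + 1) ≤ M by omega)
    obtain _ | i := i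
    · simp_all [motzkinDeriv]
    · have h₅ := ih (show k + i ≤ M by omega)
      simp only [motzkinDeriv, add_apply, smul_apply,
        smul_eq_mul, h₁, h₂, h₃, h₄, h₅]
      simp

theorem motzkinDeriv_apply_eq_prod
    (ha : ∀ i, a' i e = if 2 * i = M then 1 else 0)
    (hb : ∀ i, b' i e = if 2 * i + 1 = M then 1 else 0)
    {k i : ℕ} (hik : i < k) (h : k + i = M + 1) :
    motzkinDeriv a b a' b' k i e = ∏ l ∈ Finset.Ico i (M / 2), b l := by
  induction k generalizing i with
  | zero => omega
  | succ k ih =>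
    have hstep : motzkinDeriv a b a' b' (k + 1) i e =
        motzkinWeight a b k i * a' i e + (b i * motzkinDeriv a b a' b' k (i + 1) e
          + motzkinWeight a b k (i + 1) * b' i e) := by
      have h₁ := motzkinDeriv_apply_eq_zero a b ha hb (show k + i ≤ M by omega)
      obtain _ | i := i
      · simp [motzkinDeriv, h₁]
      · have h₂ := motzkinDeriv_apply_eq_zero a b ha hb (show k + i ≤ M by omega)
        simp [motzkinDeriv, h₁, h₂]
    rw [hstep, ha, hb]
    obtain rfl | rfl | hk : k = i ∨ k = i + 1 ∨ i + 1 < k := by omega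
    · rw [motzkinDeriv_eq_zero_of_le a b a' b' (show k ≤ k + 1 by omega), motzkinWeight_self,
        if_pos (by omega), if_neg (by omega), Finset.Ico_eq_empty (by omega)]
      simp
    · rw [motzkinDeriv_eq_zero_of_le a b a' b' le_rfl, motzkinWeight_self,
        if_neg (by omega), if_pos (by omega), Finset.Ico_eq_empty (by omega)]
      simp
    · rw [ih hk (by omega), if_neg (by omega), if_neg (by omega),
        Finset.prod_eq_prod_Ico_succ_bot (show i < M / 2 by omega)]
      simp

end Deriv

theorem prod_range_two_mul_prod_range_half (b : ℕ → ℝ) (n : ℕ) :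
    ∏ k ∈ Finset.range (2 * n), ∏ l ∈ Finset.range (k / 2), b l =
      ∏ j ∈ Finset.range (n - 1), b j ^ (2 * n - 2 * (j + 1)) := by
  induction n with
  | zero => simp
  | succ n ih =>
    rw [show 2 * (n + 1) = 2 * n + 1 + 1 by ring, Finset.prod_range_succ, Finset.prod_range_succ,
      ih, show (2 * n + 1) / 2 = n by omega, show 2 * n / 2 = n by omega, mul_assoc, ← sq,
      ← Finset.prod_pow, Nat.add_sub_cancel]
    obtain _ | n := n
    · simp
    rw [Nat.add_sub_cancel, Finset.prod_range_succ, Finset.prod_range_succ, ← mul_assoc,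
      ← Finset.prod_mul_distrib]
    congr 1
    · refine Finset.prod_congr rfl fun j hj => ?_
      rw [Finset.mem_range] at hj
      rw [← pow_add]
      congr 1
      omega
    · congr 1
      omega

/-- The `m`-th coordinate functional on `ℝ^N`, extended by `0` to `m ≥ N`. -/
def coordOrZero (N m : ℕ) : (Fin N → ℝ) →L[ℝ] ℝ :=
  if h : m < N then ContinuousLinearMap.proj ⟨m, h⟩ else 0

theorem coordOrZero_apply (N m : ℕ) (v : Fin N → ℝ) :
    coordOrZero N m v = if h : m < N then v ⟨m, h⟩ else 0 := by
  unfold coordOrZero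
  split_ifs <;> rfl

theorem coordOrZero_single {N : ℕ} (m : ℕ) (j : Fin N) :
    coordOrZero N m (Pi.single j 1) = if m = j then 1 else 0 := by
  rw [coordOrZero_apply]
  split_ifs <;> simp_all [Fin.ext_iff]

theorem phiEven_apply {n : ℕ} {v : Fin (2 * n) → ℝ}
    (hβ : ∀ i : ℕ, ∀ h : 2 * i + 1 < 2 * n, 0 < v ⟨2 * i + 1, h⟩) (k : Fin (2 * n)) :
    phiEven n v k = motzkinWeight (fun i => coordOrZero (2 * n) (2 * i) v)
      (fun i => coordOrZero (2 * n) (2 * i + 1) v) (k + 1) 0 := by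
  simp only [phiEven, coordOrZero_apply]
  rw [jacobiT_pow_apply_zero]
  · simp
  · intro i
    split_ifs with h
    exacts [(hβ i h).le, le_rfl]
  · simp

theorem hasFDerivAt_phiEven {n : ℕ} {v : Fin (2 * n) → ℝ}
    (hβ : ∀ i : ℕ, ∀ h : 2 * i + 1 < 2 * n, 0 < v ⟨2 * i + 1, h⟩) :
    HasFDerivAt (phiEven n) (ContinuousLinearMap.pi fun k : Fin (2 * n) =>
      motzkinDeriv (fun i => coordOrZero (2 * n) (2 * i) v)
        (fun i => coordOrZero (2 * n) (2 * i + 1) v) (fun i => coordOrZero (2 * n) (2 * i))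
        (fun i => coordOrZero (2 * n) (2 * i + 1)) (k + 1) 0) v := by
  have hpos : ∀ᶠ w : Fin (2 * n) → ℝ in 𝓝 v,
      ∀ i : ℕ, ∀ h : 2 * i + 1 < 2 * n, 0 < w ⟨2 * i + 1, h⟩ := by
    have : ∀ᶠ w : Fin (2 * n) → ℝ in 𝓝 v,
        ∀ j : Fin (2 * n), (j : ℕ) % 2 = 1 → 0 < w j := by
      refine eventually_all.2 fun j => ?_
      by_cases hj : (j : ℕ) % 2 = 1
      · have hv : 0 < v j := by
          convert hβ (j / 2) (by omega) using 2
          ext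
          dsimp only
          omega
        filter_upwards [(continuous_apply j).continuousAt.eventually (lt_mem_nhds hv)] with w hw _
        exact hw
      · simp [hj]
    filter_upwards [this] with w hw i h
    exact hw _ (by dsimp only; omega)
  refine hasFDerivAt_pi.2 fun k => ?_
  refine HasFDerivAt.congr_of_eventuallyEq ?_ (hpos.mono fun w hw => phiEven_apply hw k)
  exact hasFDerivAt_motzkinWeight (fun i => (coordOrZero (2 * n) (2 * i)).hasFDerivAt)
    (fun i => (coordOrZero (2 * n) (2 * i + 1)).hasFDerivAt) (k + 1) 0

/-- On the domain where all `β_j > 0`, the map `φ_{2n}` is differentiable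
and the determinant of its Jacobian (in the coordinate order `α_1,β_1,…,α_n,β_n`) equals
`∏_{j=1}^{n-1} β_j^{2n-2j}`. -/
theorem statement7 (n : ℕ) (hn : 1 ≤ n) (v : Fin (2 * n) → ℝ)
    (hβ : ∀ i : ℕ, ∀ h : 2 * i + 1 < 2 * n, 0 < v ⟨2 * i + 1, h⟩) :
    DifferentiableAt ℝ (phiEven n) v ∧
    LinearMap.det (fderiv ℝ (phiEven n) v).toLinearMap =
      ∏ j ∈ Finset.Icc 1 (n - 1),
        (if h : 2 * j - 1 < 2 * n then v ⟨2 * j - 1, h⟩ else 0) ^ (2 * n - 2 * j) := by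
  have hd := hasFDerivAt_phiEven hβ
  refine ⟨hd.differentiableAt, ?_⟩
  have ha (j : Fin (2 * n)) (i : ℕ) := coordOrZero_single (2 * i) j
  have hb (j : Fin (2 * n)) (i : ℕ) := coordOrZero_single (2 * i + 1) j
  rw [hd.fderiv, ← LinearMap.det_toMatrix', Matrix.det_of_isLowerTriangular]
  · have hdiag (k : Fin (2 * n)) := motzkinDeriv_apply_eq_prod
      (fun i => coordOrZero (2 * n) (2 * i) v) (fun i => coordOrZero (2 * n) (2 * i + 1) v)
      (ha k) (hb k) (k : ℕ).succ_pos rfl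
    simp only [LinearMap.toMatrix'_apply, ContinuousLinearMap.coe_coe,
      ContinuousLinearMap.coe_pi', hdiag, Nat.Ico_zero_eq_range]
    rw [Fin.prod_univ_eq_prod_range (fun k => ∏ l ∈ Finset.range (k / 2),
      coordOrZero (2 * n) (2 * l + 1) v) (2 * n), prod_range_two_mul_prod_range_half,
      ← Finset.Ico_add_one_right_eq_Icc, Finset.prod_Ico_eq_prod_range, Nat.add_sub_cancel]
    refine Finset.prod_congr rfl fun j _ => ?_
    rw [← coordOrZero_apply (2 * n), show 2 * (1 + j) - 1 = 2 * j + 1 by omega, add_comm 1 j]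
  · intro k j hkj
    have hkj' : (k : ℕ) < j := hkj
    simp only [LinearMap.toMatrix'_apply, ContinuousLinearMap.coe_coe, ContinuousLinearMap.coe_pi']
    exact motzkinDeriv_apply_eq_zero _ _ (ha j) (hb j) (show (k : ℕ) + 1 + 0 ≤ j by omega)
end
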